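/- arXiv:cs/0209012 — 2 statements merged into one kernel-verified Lean document; each statement's English description precedes it below -/
import Mathlib

section
/- Let 0 < α ≤ 5π/6, let R > 0, let V be a finite set of points of the Euclidean plane, let r : V → ℝ be a CBTC(α)-valid radius assignment, and let u, v ∈ V be distinct with dist u v ≤ R. Then either u and v are adjacent in G_α, or there exists a finite sequence of points u = u_0, u_1, …, u_k = v in V such that for every i < k, u_i and u_{i+1} are adjacent in G_α and dist u_i u_{i+1} < dist u v. -/
open EuclideanGeometry Real

noncomputable section

/-- The Euclidean plane. -/
abbrev EPlane := EuclideanSpace ℝ (Fin 2)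

/-- Adjacency in the graph `G_R`: two distinct points of `V` at distance at most `R`. -/
def GRAdj (R : ℝ) (V : Finset EPlane) (u v : EPlane) : Prop :=
  u ∈ V ∧ v ∈ V ∧ u ≠ v ∧ dist u v ≤ R

/-- A radius assignment `r` is CBTC(α)-valid if every `u ∈ V` has `0 < r u ≤ R` and
either `r u = R` or `u` has no α-gap: every direction `e` is within angle `α/2`
of some neighbor of `u` at distance at most `r u`. -/
def CBTCValid (α R : ℝ) (V : Finset EPlane) (r : EPlane → ℝ) : Prop :=
  ∀ u ∈ V, (0 < r u ∧ r u ≤ R) ∧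
    (r u = R ∨ ∀ e : EPlane, e ≠ 0 → ∃ v ∈ V, v ≠ u ∧ dist u v ≤ r u ∧
      InnerProductGeometry.angle (v - u) e ≤ α / 2)

/-- Adjacency in the graph `G_α` (symmetric closure of `N_α`):
two distinct points of `V` with `dist u v ≤ max (r u) (r v)`. -/
def GAlphaAdj (V : Finset EPlane) (r : EPlane → ℝ) (u v : EPlane) : Prop :=
  u ∈ V ∧ v ∈ V ∧ u ≠ v ∧ dist u v ≤ max (r u) (r v)

theorem Real.cos_le_neg_one_half {x : ℝ} (h₁ : 2 * π / 3 ≤ x) (h₂ : x ≤ 4 * π / 3) :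
    cos x ≤ -(1 / 2) := by
  have h : cos (π / 3) ≤ cos (x - π) := by
    rw [← cos_abs (x - π)]
    refine cos_le_cos_of_nonneg_of_le_pi (abs_nonneg _) (by linarith [pi_pos]) ?_
    rw [abs_le]
    constructor <;> linarith
  rw [cos_pi_div_three, cos_sub_pi] at h
  linarith

theorem abs_le_of_cos_five_pi_div_twelve_le {x : ℝ} (hx : |x| ≤ π + π / 12)
    (h : cos (5 * π / 12) ≤ cos x) : |x| ≤ 5 * π / 12 := by
  by_contra! hlt
  rw [← cos_abs x] at h
  have hpi := pi_pos
  rcases le_total |x| π with hle | hle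
  · exact absurd (cos_lt_cos_of_nonneg_of_le_pi (by positivity) hle hlt) (not_lt.2 h)
  · rw [← cos_two_pi_sub |x|] at h
    exact absurd (cos_lt_cos_of_nonneg_of_le_pi (x := 5 * π / 12) (y := 2 * π - |x|)
      (by positivity) (by linarith) (by linarith)) (not_lt.2 h)

/-- In a quadrilateral with base of length `1`, legs `a, b < 1` on the same side of the base with
base angles `η, φ`, and diagonals of length at least `1`, the fourth side is shorter than `1`.
By the law of cosines, this is the following inequality. -/
theorem quadrilateral_side_lt_one {a b η φ : ℝ} (ha1 : a < 1) (hb0 : 0 < b) (hb1 : b < 1)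
    (ha : 2 * cos η ≤ a) (hb : 2 * cos φ ≤ b) (hη : π / 3 < η) (hη' : η ≤ π / 2)
    (hφ : π / 3 < φ) (hφ' : φ ≤ π / 2) (h₁ : φ + 2 * η ≤ 4 * π / 3)
    (h₂ : η + 2 * φ ≤ 4 * π / 3) :
    a ^ 2 + b ^ 2 - 2 * a * cos η - 2 * b * cos φ + 2 * a * b * cos (η + φ) < 0 := by
  have hpi := pi_pos
  have hc0 : 0 ≤ cos η := cos_nonneg_of_neg_pi_div_two_le_of_le (by linarith) hη'
  have hd0 : 0 ≤ cos φ := cos_nonneg_of_neg_pi_div_two_le_of_le (by linarith) hφ'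
  have hsη : 0 ≤ sin η := sin_nonneg_of_nonneg_of_le_pi (by linarith) (by linarith)
  have hsφ : 0 ≤ sin φ := sin_nonneg_of_nonneg_of_le_pi (by linarith) (by linarith)
  have e₁ : 4 * cos η * cos (η + φ) = 2 * cos (φ + 2 * η) + 2 * cos φ := by
    have h1 : φ + 2 * η = (η + φ) + η := by ring
    have h2 : cos φ = cos ((η + φ) - η) := by congr 1; ring
    rw [h1, h2, cos_add (η + φ) η, cos_sub (η + φ) η]; ring
  have e₂ : 4 * cos φ * cos (η + φ) = 2 * cos (η + 2 * φ) + 2 * cos η := by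
    have h1 : η + 2 * φ = (η + φ) + φ := by ring
    have h2 : cos η = cos ((η + φ) - φ) := by congr 1; ring
    rw [h1, h2, cos_add (η + φ) φ, cos_sub (η + φ) φ]; ring
  have k₁ := Real.cos_le_neg_one_half (x := φ + 2 * η) (by linarith) h₁
  have k₂ := Real.cos_le_neg_one_half (x := η + 2 * φ) (by linarith) h₂
  have hcorner : 1 - cos η - cos φ + cos (η + φ) ≤ 0 := by
    have h1 : 1 - cos η ≤ sin η :=
      abs_le_of_sq_le_sq' (by nlinarith [sin_sq_add_cos_sq η]) hsη |>.2
    have h2 : 1 - cos φ ≤ sin φ :=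
      abs_le_of_sq_le_sq' (by nlinarith [sin_sq_add_cos_sq φ]) hsφ |>.2
    have h3 := mul_le_mul h1 h2 (by linarith) hsη
    rw [cos_add]
    linarith
  generalize cos (φ + 2 * η) = m at *
  generalize cos (η + 2 * φ) = n at *
  generalize cos (η + φ) = k at *
  generalize cos η = c at *
  generalize cos φ = d at *
  have hleft : b ^ 2 - 2 * b * d + 4 * b * c * k < 0 := by
    have : b ^ 2 - 2 * b * d + 4 * b * c * k = b * (b + 2 * m) := by linear_combination b * e₁
    rw [this]
    exact mul_neg_of_pos_of_neg hb0 (by linarith)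
  have hright : 1 + b ^ 2 - 2 * c - 2 * b * d + 2 * b * k ≤ 0 := by
    have hconv : (1 - 2 * d) * (1 + b ^ 2 - 2 * c - 2 * b * d + 2 * b * k) =
        (1 - b) * (1 + 2 * n) + (b - 2 * d) * (2 * (1 - c - d + k))
          - (1 - 2 * d) * ((1 - b) * (b - 2 * d)) := by
      linear_combination (1 - b) * e₂
    have h1 : (1 - b) * (1 + 2 * n) ≤ 0 :=
      mul_nonpos_of_nonneg_of_nonpos (by linarith) (by linarith)
    have h2 : (b - 2 * d) * (2 * (1 - c - d + k)) ≤ 0 :=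
      mul_nonpos_of_nonneg_of_nonpos (by linarith) (by linarith)
    have h3 : 0 ≤ (1 - 2 * d) * ((1 - b) * (b - 2 * d)) :=
      mul_nonneg (by linarith) (mul_nonneg (by linarith) (by linarith))
    refine nonpos_of_mul_nonpos_right (a := 1 - 2 * d) ?_ (by linarith)
    linarith
  have hconv : (1 - 2 * c) * (a ^ 2 + b ^ 2 - 2 * a * c - 2 * b * d + 2 * a * b * k) =
      (1 - a) * (b ^ 2 - 2 * b * d + 4 * b * c * k)
        + (a - 2 * c) * (1 + b ^ 2 - 2 * c - 2 * b * d + 2 * b * k)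
        - (1 - 2 * c) * ((1 - a) * (a - 2 * c)) := by ring
  have h1 := mul_neg_of_pos_of_neg (sub_pos.2 ha1) hleft
  have h2 := mul_nonpos_of_nonneg_of_nonpos (sub_nonneg.2 ha) hright
  have h3 : 0 ≤ (1 - 2 * c) * ((1 - a) * (a - 2 * c)) :=
    mul_nonneg (by linarith) (mul_nonneg (by linarith) (by linarith))
  refine neg_of_mul_neg_right (a := 1 - 2 * c) ?_ (by linarith)
  linarith

theorem Complex.sq_norm_one_sub (z : ℂ) :
    ‖1 - z‖ ^ 2 = 1 + ‖z‖ ^ 2 - 2 * ‖z‖ * Real.cos z.arg := by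
  have h := Complex.norm_mul_cos_arg z
  rw [mul_assoc, h, Complex.sq_norm, Complex.sq_norm, Complex.normSq_apply, Complex.normSq_apply]
  simp
  ring

theorem Complex.sq_norm_one_sub_sub (z w : ℂ) :
    ‖1 - z - w‖ ^ 2 = 1 + ‖z‖ ^ 2 + ‖w‖ ^ 2 - 2 * ‖z‖ * Real.cos z.arg
      - 2 * ‖w‖ * Real.cos w.arg + 2 * ‖z‖ * ‖w‖ * Real.cos (z.arg - w.arg) := by
  have h : 2 * ‖z‖ * ‖w‖ * Real.cos (z.arg - w.arg) = 2 * (z.re * w.re + z.im * w.im) := by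
    rw [Real.cos_sub, ← Complex.norm_mul_cos_arg z, ← Complex.norm_mul_cos_arg w,
      ← Complex.norm_mul_sin_arg z, ← Complex.norm_mul_sin_arg w]
    ring
  rw [h, mul_assoc, Complex.norm_mul_cos_arg, mul_assoc, Complex.norm_mul_cos_arg,
    Complex.sq_norm, Complex.sq_norm, Complex.sq_norm, Complex.normSq_apply,
    Complex.normSq_apply, Complex.normSq_apply]
  simp
  ring

/-- If `0 < ‖z‖ < 1 ≤ ‖1 - z‖` then `2 * cos (arg z) ≤ ‖z‖`. -/
theorem Complex.two_mul_cos_arg_le_norm {z : ℂ} (h0 : 0 < ‖z‖) (h : 1 ≤ ‖1 - z‖) :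
    2 * Real.cos z.arg ≤ ‖z‖ := by
  have h' : 1 ≤ ‖1 - z‖ ^ 2 := one_le_pow₀ h
  rw [Complex.sq_norm_one_sub] at h'
  refine le_of_mul_le_mul_left ?_ h0
  linarith

theorem Complex.pi_div_three_lt_abs_arg {z : ℂ} (h0 : 0 < ‖z‖) (h1 : ‖z‖ < 1)
    (h : 1 ≤ ‖1 - z‖) : π / 3 < |z.arg| := by
  by_contra! hle
  have hcos := Real.cos_le_cos_of_nonneg_of_le_pi (abs_nonneg _) (by linarith [pi_pos]) hle
  rw [Real.cos_pi_div_three, Real.cos_abs] at hcos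
  linarith [Complex.two_mul_cos_arg_le_norm h0 h]

/-- The quadrilateral inequality for the point `z`, seen from the endpoint `0` of the unit segment,
and the point `1 - w`, which lies on the same side of the segment when `arg z * arg w ≤ 0`. -/
theorem Complex.norm_one_sub_sub_lt_one {z w : ℂ} (hz0 : 0 < ‖z‖) (hz1 : ‖z‖ < 1)
    (hz : 1 ≤ ‖1 - z‖) (hw0 : 0 < ‖w‖) (hw1 : ‖w‖ < 1) (hw : 1 ≤ ‖1 - w‖)
    (hs : z.arg * w.arg ≤ 0) (hz2 : |z.arg| ≤ π / 2) (hw2 : |w.arg| ≤ π / 2)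
    (h₁ : |w.arg| + 2 * |z.arg| ≤ 4 * π / 3) (h₂ : |z.arg| + 2 * |w.arg| ≤ 4 * π / 3) :
    ‖1 - z - w‖ < 1 := by
  have hcos : Real.cos (z.arg - w.arg) = Real.cos (|z.arg| + |w.arg|) := by
    rcases mul_nonpos_iff.1 hs with ⟨h1, h2⟩ | ⟨h1, h2⟩
    · rw [abs_of_nonneg h1, abs_of_nonpos h2, sub_eq_add_neg]
    · rw [abs_of_nonpos h1, abs_of_nonneg h2, ← Real.cos_neg]
      congr 1; ring
  have key := quadrilateral_side_lt_one (η := |z.arg|) (φ := |w.arg|) hz1 hw0 hw1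
    (by rw [Real.cos_abs]; exact Complex.two_mul_cos_arg_le_norm hz0 hz)
    (by rw [Real.cos_abs]; exact Complex.two_mul_cos_arg_le_norm hw0 hw)
    (Complex.pi_div_three_lt_abs_arg hz0 hz1 hz) hz2
    (Complex.pi_div_three_lt_abs_arg hw0 hw1 hw) hw2 h₁ h₂
  rw [Real.cos_abs, Real.cos_abs, ← hcos] at key
  rw [← abs_of_nonneg (norm_nonneg (1 - z - w)), ← sq_lt_one_iff_abs_lt_one,
    Complex.sq_norm_one_sub_sub]
  linarith

/-- `S` is the set of positions of the neighbors of the endpoint `0` of the unit segment `[0, 1]`,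
and `w` that of a neighbor of `1` in the frame based at `1` and pointing to `0`. If `S` leaves no
gap of angle `5π/6` and `w` is at least as close in direction to the segment as any element
of `S`, then some neighbors are at distance less than `1`. -/
theorem exists_norm_one_sub_sub_lt_one {S : Set ℂ} {w : ℂ} (hS : S.Finite)
    (hS1 : ∀ z ∈ S, 0 < ‖z‖ ∧ ‖z‖ < 1)
    (hcov : ∀ t : ℝ, ∃ z ∈ S, cos (5 * π / 12) ≤ cos (z.arg - t))
    (hS2 : ∀ z ∈ S, 1 ≤ ‖1 - z‖) (hw0 : 0 < ‖w‖) (hw1 : ‖w‖ < 1) (hw : 1 ≤ ‖1 - w‖)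
    (hmin : ∀ z ∈ S, |w.arg| ≤ |z.arg|) : ∃ z ∈ S, ‖1 - z - w‖ < 1 := by
  have hpi := pi_pos
  obtain ⟨z₁, hz₁, hz₁c⟩ := hcov 0
  obtain ⟨z, hz, hzmin⟩ := S.exists_min_image (fun z => |z.arg|) hS ⟨z₁, hz₁⟩
  rw [sub_zero] at hz₁c
  have hθ : |z.arg| ≤ 5 * π / 12 := (hzmin z₁ hz₁).trans
    (abs_le_of_cos_five_pi_div_twelve_le (by linarith [Complex.abs_arg_le_pi z₁]) hz₁c)
  have hθ' := Complex.pi_div_three_lt_abs_arg (hS1 z hz).1 (hS1 z hz).2 (hS2 z hz)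
  have hφ := hmin z hz
  by_cases hs : z.arg * w.arg ≤ 0
  · exact ⟨z, hz, Complex.norm_one_sub_sub_lt_one (hS1 z hz).1 (hS1 z hz).2 (hS2 z hz) hw0 hw1 hw
      hs (by linarith) (by linarith) (by linarith) (by linarith)⟩
  rw [not_le] at hs
  -- It is enough to find an element of `S` on the other side, in the next `5π/6`-cone.
  suffices ∃ y ∈ S, y.arg * w.arg ≤ 0 ∧ |y.arg| ≤ 2 * π / 3 - |z.arg| / 2 by
    obtain ⟨y, hy, hyw, hyz⟩ := this
    exact ⟨y, hy, Complex.norm_one_sub_sub_lt_one (hS1 y hy).1 (hS1 y hy).2 (hS2 y hy) hw0 hw1 hw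
      hyw (by linarith) (by linarith) (by linarith) (by linarith)⟩
  rcases pos_and_pos_or_neg_and_neg_of_mul_pos hs with ⟨hz0, hw0⟩ | ⟨hz0, hw0⟩
  · rw [abs_of_pos hz0] at *
    obtain ⟨y, hy, hyc⟩ := hcov (z.arg / 2 - π / 4)
    have hyπ := abs_le.1 (Complex.abs_arg_le_pi y)
    have h := abs_le.1 (abs_le_of_cos_five_pi_div_twelve_le
      (abs_le.2 ⟨by linarith, by linarith⟩) hyc)
    have hyz : z.arg ≤ |y.arg| := by simpa [abs_of_pos hz0] using hzmin y hy
    have hyneg : y.arg ≤ 0 := by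
      by_contra! hpos
      rw [abs_of_pos hpos] at hyz
      linarith
    refine ⟨y, hy, mul_nonpos_of_nonpos_of_nonneg hyneg hw0.le, ?_⟩
    rw [abs_of_nonpos hyneg]
    linarith
  · rw [abs_of_neg hz0] at *
    obtain ⟨y, hy, hyc⟩ := hcov (z.arg / 2 + π / 4)
    have hyπ := abs_le.1 (Complex.abs_arg_le_pi y)
    have h := abs_le.1 (abs_le_of_cos_five_pi_div_twelve_le
      (abs_le.2 ⟨by linarith, by linarith⟩) hyc)
    have hyz : -z.arg ≤ |y.arg| := by simpa [abs_of_neg hz0] using hzmin y hy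
    have hypos : 0 ≤ y.arg := by
      by_contra! hneg
      rw [abs_of_neg hneg] at hyz
      linarith
    refine ⟨y, hy, mul_nonpos_of_nonneg_of_nonpos hypos hw0.le, ?_⟩
    rw [abs_of_nonneg hypos]
    linarith

/-- `S` and `T` are the sets of positions of the neighbors of the two endpoints of a unit segment,
each seen in the frame based at its endpoint and pointing to the other one. If neither set leaves
a gap of angle `5π/6`, then some neighbors are at distance less than `1`. -/
theorem exists_close_neighbors_of_cover {S T : Set ℂ} (hS : S.Finite) (hT : T.Finite)
    (hS1 : ∀ z ∈ S, 0 < ‖z‖ ∧ ‖z‖ < 1) (hT1 : ∀ z ∈ T, 0 < ‖z‖ ∧ ‖z‖ < 1)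
    (hScov : ∀ t : ℝ, ∃ z ∈ S, cos (5 * π / 12) ≤ cos (z.arg - t))
    (hTcov : ∀ t : ℝ, ∃ z ∈ T, cos (5 * π / 12) ≤ cos (z.arg - t)) :
    (∃ z ∈ S, ‖1 - z‖ < 1) ∨ (∃ w ∈ T, ‖1 - w‖ < 1) ∨ ∃ z ∈ S, ∃ w ∈ T, ‖1 - z - w‖ < 1 := by
  by_contra! hcon
  obtain ⟨hS2, hT2, hST⟩ := hcon
  obtain ⟨z₁, hz₁, -⟩ := hScov 0
  obtain ⟨w₁, hw₁, -⟩ := hTcov 0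
  obtain ⟨z, hz, hzmin⟩ := S.exists_min_image (fun z => |z.arg|) hS ⟨z₁, hz₁⟩
  obtain ⟨w, hw, hwmin⟩ := T.exists_min_image (fun z => |z.arg|) hT ⟨w₁, hw₁⟩
  rcases le_total |w.arg| |z.arg| with h | h
  · obtain ⟨y, hy, hlt⟩ := exists_norm_one_sub_sub_lt_one hS hS1 hScov hS2 (hT1 w hw).1
      (hT1 w hw).2 (hT2 w hw) fun y hy => h.trans (hzmin y hy)
    exact absurd hlt (not_lt.2 (hST y hy w hw))
  · obtain ⟨y, hy, hlt⟩ := exists_norm_one_sub_sub_lt_one hT hT1 hTcov hT2 (hS1 z hz).1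
      (hS1 z hz).2 (hS2 z hz) fun y hy => h.trans (hwmin y hy)
    rw [sub_right_comm] at hlt
    exact absurd hlt (not_lt.2 (hST z hz y hy))

/-- The points of `V` other than `u` within distance `ρ` of `u`. -/
def neighborsWithin (V : Finset EPlane) (ρ : ℝ) (u : EPlane) : Set EPlane :=
  {p | p ∈ V ∧ p ≠ u ∧ dist u p ≤ ρ}

/-- Every direction at `u` is within angle `β` of the direction of an element of `N`. -/
def CoversDirections (β : ℝ) (N : Set EPlane) (u : EPlane) : Prop :=
  ∀ e : EPlane, e ≠ 0 → ∃ p ∈ N, InnerProductGeometry.angle (p - u) e ≤ β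

/-- The linear isometric identification of the plane with `ℂ`. -/
def planeToComplex : EPlane ≃ₗᵢ[ℝ] ℂ := Complex.orthonormalBasisOneI.repr.symm

/-- The coordinate of `p` in the complex frame with origin `u` and unit point `v`. -/
def frameCoord (u v p : EPlane) : ℂ :=
  planeToComplex (p - u) / planeToComplex (v - u)

theorem norm_frameCoord (u v p : EPlane) : ‖frameCoord u v p‖ = dist u p / dist u v := by
  rw [frameCoord, norm_div, LinearIsometryEquiv.norm_map, LinearIsometryEquiv.norm_map,
    ← dist_eq_norm, ← dist_eq_norm, dist_comm p, dist_comm v]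

theorem norm_one_sub_frameCoord {u v : EPlane} (huv : u ≠ v) (p : EPlane) :
    ‖1 - frameCoord u v p‖ = dist p v / dist u v := by
  have h : planeToComplex (v - u) ≠ 0 := by simpa [sub_eq_zero] using huv.symm
  rw [frameCoord, one_sub_div h, ← map_sub, sub_sub_sub_cancel_right, norm_div,
    LinearIsometryEquiv.norm_map, LinearIsometryEquiv.norm_map, ← dist_eq_norm, ← dist_eq_norm,
    dist_comm v, dist_comm v]

theorem norm_one_sub_frameCoord_sub_frameCoord {u v : EPlane} (huv : u ≠ v) (p q : EPlane) :
    ‖1 - frameCoord u v p - frameCoord v u q‖ = dist p q / dist u v := by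
  have h : planeToComplex (v - u) ≠ 0 := by simpa [sub_eq_zero] using huv.symm
  have h' : planeToComplex (u - v) = -planeToComplex (v - u) := by rw [← map_neg, neg_sub]
  have key : 1 - frameCoord u v p - frameCoord v u q =
      planeToComplex (q - p) / planeToComplex (v - u) := by
    rw [frameCoord, frameCoord, h', div_neg, one_sub_div h, sub_neg_eq_add, ← add_div, ← map_sub,
      ← map_add]
    congr 2
    abel
  rw [key, norm_div, LinearIsometryEquiv.norm_map, LinearIsometryEquiv.norm_map, ← dist_eq_norm,
    ← dist_eq_norm, dist_comm q, dist_comm v]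

theorem CoversDirections.exists_cos_le {β : ℝ} {N : Set EPlane} {u v : EPlane}
    (hN : CoversDirections β N u) (hNu : u ∉ N) (hβ : β ≤ 5 * π / 12) (huv : u ≠ v) (t : ℝ) :
    ∃ z ∈ frameCoord u v '' N, cos (5 * π / 12) ≤ cos (z.arg - t) := by
  have h : planeToComplex (v - u) ≠ 0 := by simpa [sub_eq_zero] using huv.symm
  have hexp := Complex.exp_ne_zero (t * Complex.I)
  set d := planeToComplex (v - u) * Complex.exp (t * Complex.I) with hd
  have hd0 : d ≠ 0 := mul_ne_zero h hexp
  obtain ⟨p, hp, hpe⟩ := hN (planeToComplex.symm d) (by simpa using hd0)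
  refine ⟨_, Set.mem_image_of_mem _ hp, ?_⟩
  have hpu : planeToComplex (p - u) ≠ 0 := by
    have : p ≠ u := fun h => hNu (h ▸ hp)
    simpa [sub_eq_zero] using this
  have hz : frameCoord u v p ≠ 0 := div_ne_zero hpu h
  rw [← planeToComplex.toLinearIsometry.angle_map] at hpe
  simp only [LinearIsometryEquiv.coe_toLinearIsometry, LinearIsometryEquiv.apply_symm_apply] at hpe
  rw [Complex.angle_eq_abs_arg hpu hd0, hd, ← div_div] at hpe
  have hcos : cos ((frameCoord u v p).arg - t) =
      cos (frameCoord u v p / Complex.exp (t * Complex.I)).arg := by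
    rw [← Real.Angle.cos_coe, ← Real.Angle.cos_coe, Complex.arg_div_coe_angle hz hexp,
      Complex.exp_mul_I]
    have := Complex.arg_cos_add_sin_mul_I_coe_angle (t : Real.Angle)
    simp only [Real.Angle.cos_coe, Real.Angle.sin_coe, Complex.ofReal_cos,
      Complex.ofReal_sin] at this
    rw [this, Real.Angle.coe_sub]
  rw [hcos, ← cos_abs (Complex.arg _)]
  exact cos_le_cos_of_nonneg_of_le_pi (abs_nonneg _) (by linarith [pi_pos]) (hpe.trans hβ)

/-- If `u` and `v` have neighbors without gaps of angle `5π/6`, all closer than `dist u v`, then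
moving `u`, `v` or both to a neighbor shortens the distance. -/
theorem exists_dist_lt_of_coversDirections {β : ℝ} (hβ : β ≤ 5 * π / 12) {M N : Set EPlane}
    (hM : M.Finite) (hN : N.Finite) {u v : EPlane} (huv : u ≠ v) (hMu : u ∉ M) (hNv : v ∉ N)
    (hMd : ∀ p ∈ M, dist u p < dist u v) (hNd : ∀ p ∈ N, dist v p < dist u v)
    (hMc : CoversDirections β M u) (hNc : CoversDirections β N v) :
    (∃ p ∈ M, dist p v < dist u v) ∨ (∃ q ∈ N, dist u q < dist u v) ∨
      ∃ p ∈ M, ∃ q ∈ N, dist p q < dist u v := by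
  have hd : 0 < dist u v := dist_pos.2 huv
  have key := exists_close_neighbors_of_cover (hM.image (frameCoord u v))
    (hN.image (frameCoord v u)) ?_ ?_ (hMc.exists_cos_le hMu hβ huv)
    (hNc.exists_cos_le hNv hβ huv.symm)
  · simpa only [Set.exists_mem_image, norm_one_sub_frameCoord huv,
      norm_one_sub_frameCoord huv.symm, norm_one_sub_frameCoord_sub_frameCoord huv,
      dist_comm v u, div_lt_one hd, fun q => dist_comm q u] using key
  · rintro _ ⟨p, hp, rfl⟩
    rw [norm_frameCoord, div_lt_one hd]
    exact ⟨div_pos (dist_pos.2 fun h => hMu (h ▸ hp)) hd, hMd p hp⟩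
  · rintro _ ⟨p, hp, rfl⟩
    rw [norm_frameCoord, dist_comm v u, div_lt_one hd]
    exact ⟨div_pos (dist_pos.2 fun h => hNv (h ▸ hp)) hd, hNd p hp⟩

theorem GAlphaAdj.symm {V : Finset EPlane} {r : EPlane → ℝ} {u v : EPlane}
    (h : GAlphaAdj V r u v) : GAlphaAdj V r v u :=
  ⟨h.2.1, h.1, h.2.2.1.symm, by rw [dist_comm, max_comm]; exact h.2.2.2⟩

theorem gAlphaAdj_of_mem_neighborsWithin {V : Finset EPlane} {r : EPlane → ℝ} {u p : EPlane}
    (hu : u ∈ V) (hp : p ∈ neighborsWithin V (r u) u) : GAlphaAdj V r u p :=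
  ⟨hu, hp.1, hp.2.1.symm, hp.2.2.trans (le_max_left _ _)⟩

theorem CBTCValid.coversDirections {α R : ℝ} {V : Finset EPlane} {r : EPlane → ℝ}
    (hr : CBTCValid α R V r) {u : EPlane} (hu : u ∈ V) (h : r u < R) :
    CoversDirections (α / 2) (neighborsWithin V (r u) u) u := by
  intro e he
  obtain ⟨p, hp, hpu, hd, hang⟩ := ((hr u hu).2.resolve_left h.ne) e he
  exact ⟨p, ⟨hp, hpu, hd⟩, hang⟩

theorem Relation.ReflTransGen.exists_seq {X : Type*} {ρ : X → X → Prop} {a b : X}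
    (h : Relation.ReflTransGen ρ a b) :
    ∃ (k : ℕ) (p : ℕ → X), p 0 = a ∧ p k = b ∧ ∀ i < k, ρ (p i) (p (i + 1)) := by
  induction h using Relation.ReflTransGen.head_induction_on with
  | refl => exact ⟨0, fun _ => b, rfl, rfl, by simp⟩
  | @head a c hac _ ih =>
    obtain ⟨k, p, h0, hk, hp⟩ := ih
    refine ⟨k + 1, fun i => Nat.casesOn i a p, rfl, hk, ?_⟩
    rintro (_ | i) hi
    · simpa [h0] using hac
    · exact hp i (by omega)

/-- The edges of `G_α` shorter than `D`. -/
def ShortAdj (V : Finset EPlane) (r : EPlane → ℝ) (D : ℝ) (p q : EPlane) : Prop :=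
  GAlphaAdj V r p q ∧ dist p q < D

/-- Points of `V` at distance at most `R` that are not adjacent in `G_α` are joined by a path in
`G_α` with edges shorter than their distance. -/
theorem CBTCValid.reflTransGen_shortAdj {α R : ℝ} (hα : α ≤ 5 * π / 6) {V : Finset EPlane}
    {r : EPlane → ℝ} (hr : CBTCValid α R V r) {u v : EPlane} (hu : u ∈ V) (hv : v ∈ V)
    (hd : dist u v ≤ R) (hadj : ¬ GAlphaAdj V r u v) :
    Relation.ReflTransGen (ShortAdj V r (dist u v)) u v := by
  induction hn : ((V ×ˢ V).filter fun x => dist x.1 x.2 < dist u v).card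
    using Nat.strong_induction_on generalizing u v with
  | _ n ih =>
  subst hn
  rcases eq_or_ne u v with rfl | huv
  · exact .refl
  have hmax : max (r u) (r v) < dist u v := by
    by_contra! h
    exact hadj ⟨hu, hv, huv, h⟩
  obtain ⟨hru, hrv⟩ := max_lt_iff.1 hmax
  have hstep : ∀ p ∈ V, ∀ q ∈ V, dist p q < dist u v →
      Relation.ReflTransGen (ShortAdj V r (dist u v)) p q := by
    intro p hp q hq hpq
    by_cases h : GAlphaAdj V r p q
    · exact .single ⟨h, hpq⟩
    have hle : ShortAdj V r (dist p q) ≤ ShortAdj V r (dist u v) :=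
      fun a b hab => ⟨hab.1, hab.2.trans hpq⟩
    refine Relation.ReflTransGen.mono hle _ _
      (ih _ (Finset.card_lt_card ?_) hp hq (hpq.le.trans hd) h rfl)
    rw [Finset.ssubset_iff_of_subset fun x hx => by
      rw [Finset.mem_filter] at hx ⊢; exact ⟨hx.1, hx.2.trans hpq⟩]
    exact ⟨(p, q), by simp [hp, hq, hpq], by simp⟩
  have hfst : ∀ p ∈ neighborsWithin V (r u) u, ShortAdj V r (dist u v) u p := fun p hp =>
    ⟨gAlphaAdj_of_mem_neighborsWithin hu hp, hp.2.2.trans_lt hru⟩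
  have hsnd : ∀ q ∈ neighborsWithin V (r v) v, ShortAdj V r (dist u v) q v := fun q hq =>
    ⟨(gAlphaAdj_of_mem_neighborsWithin hv hq).symm, by
      rw [dist_comm q]; exact hq.2.2.trans_lt hrv⟩
  have hfin : ∀ ρ x, (neighborsWithin V ρ x).Finite := fun ρ x =>
    V.finite_toSet.subset fun p hp => hp.1
  rcases exists_dist_lt_of_coversDirections (β := α / 2) (by linarith) (hfin (r u) u)
    (hfin (r v) v) huv (fun h => h.2.1 rfl) (fun h => h.2.1 rfl)
    (fun p hp => hp.2.2.trans_lt hru) (fun q hq => hq.2.2.trans_lt hrv)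
    (hr.coversDirections hu (hru.trans_le hd)) (hr.coversDirections hv (hrv.trans_le hd))
    with ⟨p, hp, h⟩ | ⟨q, hq, h⟩ | ⟨p, hp, q, hq, h⟩
  · exact (hstep p hp.1 v hv h).head (hfst p hp)
  · exact (hstep u hu q hq.1 h).tail (hsnd q hq)
  · exact ((hstep p hp.1 q hq.1 h).head (hfst p hp)).tail (hsnd q hq)

/-- If `(u,v)` is an edge of `G_R`, then either `u` and `v` are adjacent in `G_α`,
or they are joined by a path in `G_α` all of whose edges are shorter than `dist u v`. -/
theorem cbtc_short_path (α R : ℝ) (hα : 0 < α) (hα' : α ≤ 5 * Real.pi / 6)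
    (hR : 0 < R) (V : Finset EPlane) (r : EPlane → ℝ) (hr : CBTCValid α R V r)
    (u v : EPlane) (hu : u ∈ V) (hv : v ∈ V) (huv : u ≠ v) (hd : dist u v ≤ R) :
    GAlphaAdj V r u v ∨
      ∃ (k : ℕ) (p : ℕ → EPlane), p 0 = u ∧ p k = v ∧
        ∀ i < k, GAlphaAdj V r (p i) (p (i + 1)) ∧ dist (p i) (p (i + 1)) < dist u v := by
  by_cases hadj : GAlphaAdj V r u v
  · exact .inl hadj
  · exact .inr (hr.reflTransGen_shortAdj hα' hu hv hd hadj).exists_seq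
end
end

section
/- (Asymmetric edge removal.) Let 0 < α ≤ 2π/3, let R > 0, let V be a finite set of points of the Euclidean plane, and let r : V → ℝ be a CBTC(α)-valid radius assignment. Then the graph G_α⁻, which joins two distinct points u, v ∈ V iff dist u v ≤ min (r u) (r v), preserves the connectivity of G_R: for all u, v ∈ V, u and v are joined by a path in G_α⁻ if and only if they are joined by a path in G_R. -/
open EuclideanGeometry Real

noncomputable section

/-- Adjacency in `G_α⁻` (the largest symmetric relation contained in `N_α`):
two distinct points of `V` with `dist u v ≤ min (r u) (r v)`. -/
def GAlphaMinusAdj (V : Finset EPlane) (r : EPlane → ℝ) (u v : EPlane) : Prop :=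
  u ∈ V ∧ v ∈ V ∧ u ≠ v ∧ dist u v ≤ min (r u) (r v)

/-- In a triangle with an angle of at most `π / 3` between a side and a strictly longer side,
the third side is strictly shorter than the longer one. -/
theorem norm_sub_lt_of_angle_le_pi_div_three {E : Type*} [NormedAddCommGroup E]
    [InnerProductSpace ℝ E] {x y : E} (hx : x ≠ 0) (hxy : ‖x‖ < ‖y‖)
    (h : InnerProductGeometry.angle x y ≤ π / 3) : ‖x - y‖ < ‖y‖ := by
  have hx0 : 0 < ‖x‖ := norm_pos_iff.mpr hx
  have hcos : 1 / 2 ≤ Real.cos (InnerProductGeometry.angle x y) := by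
    rw [← Real.cos_pi_div_three]
    exact Real.cos_le_cos_of_nonneg_of_le_pi (InnerProductGeometry.angle_nonneg x y)
      (by linarith [Real.pi_pos]) h
  have hinner : ‖x‖ * ‖y‖ / 2 ≤ inner ℝ x y := by
    rw [← InnerProductGeometry.cos_angle_mul_norm_mul_norm x y]
    nlinarith [mul_nonneg hx0.le (norm_nonneg y)]
  refine lt_of_pow_lt_pow_left₀ 2 (norm_nonneg y) ?_
  rw [norm_sub_sq_real]
  nlinarith [mul_pos hx0 (sub_pos.mpr hxy)]

theorem GAlphaMinusAdj.gRAdj {α R : ℝ} {V : Finset EPlane} {r : EPlane → ℝ}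
    (hr : CBTCValid α R V r) {u v : EPlane} (h : GAlphaMinusAdj V r u v) : GRAdj R V u v := by
  obtain ⟨hu, hv, hne, hd⟩ := h
  exact ⟨hu, hv, hne, hd.trans ((min_le_left _ _).trans (hr u hu).1.2)⟩

/-- If `v` is in range `R` of `u` but beyond the radius of `u`, then some `w` is strictly closer
than `dist u v` to both `u` and `v`. -/
theorem CBTCValid.exists_closer {α R : ℝ} {V : Finset EPlane} {r : EPlane → ℝ}
    (hr : CBTCValid α R V r) (hα : α ≤ 2 * π / 3) {u v : EPlane} (hu : u ∈ V)
    (hR : dist u v ≤ R) (hlt : r u < dist u v) :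
    ∃ w ∈ V, dist u w < dist u v ∧ dist w v < dist u v := by
  obtain ⟨⟨hpos, -⟩, hgap⟩ := hr u hu
  have hvu : v - u ≠ 0 := sub_ne_zero.mpr (dist_pos.mp (hpos.trans hlt)).symm
  obtain ⟨w, hw, hwu, hd, hangle⟩ := (hgap.resolve_left (hlt.trans_le hR).ne) _ hvu
  have hcloser : dist u w < dist u v := hd.trans_lt hlt
  refine ⟨w, hw, hcloser, ?_⟩
  have hnorm : ‖w - u‖ < ‖v - u‖ := by
    rwa [← dist_eq_norm, ← dist_eq_norm, dist_comm w, dist_comm v]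
  have key := norm_sub_lt_of_angle_le_pi_div_three (sub_ne_zero.mpr hwu) hnorm
    (by linarith)
  rwa [sub_sub_sub_cancel_right, ← dist_eq_norm, ← dist_eq_norm, dist_comm v] at key

theorem CBTCValid.reflTransGen_of_dist_le {α R : ℝ} {V : Finset EPlane} {r : EPlane → ℝ}
    (hr : CBTCValid α R V r) (hα : α ≤ 2 * π / 3) {u v : EPlane} (hu : u ∈ V) (hv : v ∈ V)
    (hd : dist u v ≤ R) : Relation.ReflTransGen (GAlphaMinusAdj V r) u v := by
  classical
  by_contra hcon
  let S := (V ×ˢ V).filter fun p =>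
    dist p.1 p.2 ≤ R ∧ ¬ Relation.ReflTransGen (GAlphaMinusAdj V r) p.1 p.2
  have hS : S.Nonempty := ⟨(u, v), by simp [S, hu, hv, hd, hcon]⟩
  obtain ⟨⟨a, b⟩, hab, hmin⟩ := S.exists_min_image (fun p => dist p.1 p.2) hS
  simp only [S, Finset.mem_filter, Finset.mem_product] at hab hmin
  obtain ⟨⟨ha, hb⟩, habR, habn⟩ := hab
  have conn : ∀ x ∈ V, ∀ y ∈ V, dist x y < dist a b →
      Relation.ReflTransGen (GAlphaMinusAdj V r) x y := by
    intro x hx y hy hxy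
    by_contra h
    exact (hmin (x, y) ⟨⟨hx, hy⟩, hxy.le.trans habR, h⟩).not_gt hxy
  have hne : a ≠ b := by
    rintro rfl
    exact habn .refl
  have hlong : r a < dist a b ∨ r b < dist a b := by
    by_contra! h
    exact habn (.single ⟨ha, hb, hne, le_min h.1 h.2⟩)
  rcases hlong with hlt | hlt
  · obtain ⟨w, hw, haw, hwb⟩ := hr.exists_closer hα ha habR hlt
    exact habn ((conn a ha w hw haw).trans (conn w hw b hb hwb))
  · rw [dist_comm a b] at hlt habR
    obtain ⟨w, hw, hbw, hwa⟩ := hr.exists_closer hα hb habR hlt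
    rw [dist_comm b w, dist_comm b a] at hbw
    rw [dist_comm w a, dist_comm b a] at hwa
    exact habn ((conn a ha w hw hwa).trans (conn w hw b hb hbw))

/-- Asymmetric edge removal: for `0 < α ≤ 2π/3` and a CBTC(α)-valid radius
assignment, the graph `G_α⁻` preserves the connectivity of `G_R`. -/
theorem cbtc_asymmetric_removal_connectivity (α R : ℝ) (hα : 0 < α)
    (hα' : α ≤ 2 * Real.pi / 3) (hR : 0 < R) (V : Finset EPlane) (r : EPlane → ℝ)
    (hr : CBTCValid α R V r) (u v : EPlane) (hu : u ∈ V) (hv : v ∈ V) :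
    Relation.ReflTransGen (GAlphaMinusAdj V r) u v ↔
      Relation.ReflTransGen (GRAdj R V) u v := by
  constructor
  · exact Relation.ReflTransGen.mono (fun _ _ h => GAlphaMinusAdj.gRAdj hr h) u v
  · intro h
    induction h with
    | refl => exact .refl
    | tail _ hadj ih =>
      obtain ⟨hb, hc, -, hd⟩ := hadj
      exact (ih hb).trans (hr.reflTransGen_of_dist_le hα' hb hc hd)
end
end
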